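/- arXiv:2003.08117 — 3 statements merged into one kernel-verified Lean document; each statement's English description precedes it below -/
import Mathlib

section
/- For every δ > 0 and ε > 0 there exists Q₀ such that for every integer q ≥ Q₀ and every n ≥ 1 with H·n ≤ (1−δ)·log q, one has (1/2)·‖μ_n mod q − u_q‖ ≥ 1 − ε. -/
open scoped Classical

/-- One step of the process: the law of `b + a·Y` where `b ~ μ` and `Y ~ f` are independent,
i.e. `μ * (m_a)_* f`. -/
noncomputable def step (a : ℤ) (μ f : ℤ → ℝ) : ℤ → ℝ :=
  fun x => ∑' y : ℤ, μ (x - a * y) * f y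

/-- `walk a μ n` is the law `μ_n` of `X_n`, where `X_0 = 0` and `X_{n+1} = a·X_n + b_{n+1}`. -/
noncomputable def walk (a : ℤ) (μ : ℤ → ℝ) : ℕ → ℤ → ℝ
  | 0 => fun x => if x = 0 then 1 else 0
  | n + 1 => step a μ (walk a μ n)

/-- Reduction of a measure on `ℤ` modulo `q` (pushforward to `ZMod q`). -/
noncomputable def modq (q : ℕ) (f : ℤ → ℝ) : ZMod q → ℝ :=
  fun x => ∑' y : ℤ, if (y : ZMod q) = x then f y else 0

/-- The ℓ¹ distance `‖f mod q − u_q‖` from the reduction of `f` to the uniform measure. -/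
noncomputable def distUnif (q : ℕ) (f : ℤ → ℝ) : ℝ :=
  ∑' x : ZMod q, |modq q f x - 1 / q|

/-- Entropy of a measure on `ℤ`. -/
noncomputable def entropy (f : ℤ → ℝ) : ℝ :=
  -∑' x : ℤ, f x * Real.log (f x)

/-- `μ` is a finitely supported probability measure on `ℤ` with
`gcd(supp μ − supp μ) = 1`. -/
structure IsGoodMeasure (μ : ℤ → ℝ) : Prop where
  nonneg : ∀ x, 0 ≤ μ x
  finsupp : (Function.support μ).Finite
  total : (∑' x, μ x) = 1
  gcd_one : ∀ d : ℤ, (∀ x ∈ Function.support μ, ∀ y ∈ Function.support μ, d ∣ x - y) → IsUnit d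

/-- A nonnegative, finitely supported function of total mass one on `ℤ`. -/
structure IsFinProb (f : ℤ → ℝ) : Prop where
  nonneg : ∀ x, 0 ≤ f x
  finsupp : (Function.support f).Finite
  total : ∑' x, f x = 1

/-- The power sum `∑ f(x)^s`, the exponential of `1 - s` times the Rényi entropy of order `s`. -/
noncomputable def powerSum (s : ℝ) (f : ℤ → ℝ) : ℝ := ∑' x, f x ^ s

theorem IsGoodMeasure.isFinProb {μ : ℤ → ℝ} (h : IsGoodMeasure μ) : IsFinProb μ :=
  ⟨h.nonneg, h.finsupp, h.total⟩

theorem tsum_mul_eq_sum {g : ℤ → ℝ} (hg : (Function.support g).Finite) (c : ℤ → ℝ) :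
    ∑' y, c y * g y = ∑ y ∈ hg.toFinset, c y * g y := by
  refine tsum_eq_sum fun y hy => ?_
  have : g y = 0 := by simpa using hy
  simp [this]

theorem tsum_eq_sum_support {g : ℤ → ℝ} (hg : (Function.support g).Finite) :
    ∑' y, g y = ∑ y ∈ hg.toFinset, g y := by
  simpa using tsum_mul_eq_sum hg (fun _ => 1)

theorem step_eq_sum (a : ℤ) (f : ℤ → ℝ) {g : ℤ → ℝ} (hg : (Function.support g).Finite) (x : ℤ) :
    step a f g x = ∑ y ∈ hg.toFinset, f (x - a * y) * g y :=
  tsum_mul_eq_sum hg _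

theorem finite_support_shift {f : ℤ → ℝ} (hf : (Function.support f).Finite) (c : ℤ) :
    (Function.support fun x => f (x - c)).Finite := by
  have : (Function.support fun x => f (x - c)) = (fun x => x - c) ⁻¹' Function.support f := rfl
  rw [this]
  exact hf.preimage (by intro x _ y _ h; simpa using h)

theorem finite_support_step (a : ℤ) {f g : ℤ → ℝ} (hf : (Function.support f).Finite)
    (hg : (Function.support g).Finite) : (Function.support (step a f g)).Finite := by
  refine (hg.toFinset.finite_toSet.biUnion fun y _ => finite_support_shift hf (a * y)).subset ?_
  intro x hx
  rw [Function.mem_support, step_eq_sum a f hg] at hx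
  obtain ⟨y, hy, hne⟩ := Finset.exists_ne_zero_of_sum_ne_zero hx
  exact Set.mem_biUnion hy (left_ne_zero_of_mul hne)

theorem step_nonneg (a : ℤ) {f g : ℤ → ℝ} (hf : ∀ x, 0 ≤ f x) (hg : ∀ x, 0 ≤ g x) (x : ℤ) :
    0 ≤ step a f g x :=
  tsum_nonneg fun _ => mul_nonneg (hf _) (hg _)

theorem tsum_shift (f : ℤ → ℝ) (c : ℤ) : ∑' x, f (x - c) = ∑' x, f x :=
  (Equiv.subRight c).tsum_eq f

theorem tsum_sum_shift (a : ℤ) {f : ℤ → ℝ} (hf : (Function.support f).Finite) (g : ℤ → ℝ)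
    (G : Finset ℤ) :
    ∑' x, ∑ y ∈ G, f (x - a * y) * g y = (∑' x, f x) * ∑ y ∈ G, g y := by
  rw [Summable.tsum_finsetSum, Finset.mul_sum]
  · refine Finset.sum_congr rfl fun y _ => ?_
    rw [tsum_mul_right, tsum_shift f]
  · intro y _
    exact (summable_of_hasFiniteSupport (finite_support_shift hf (a * y))).mul_right _

theorem IsFinProb.step {a : ℤ} {f g : ℤ → ℝ} (hf : IsFinProb f) (hg : IsFinProb g) :
    IsFinProb (step a f g) where
  nonneg := step_nonneg a hf.nonneg hg.nonneg
  finsupp := finite_support_step a hf.finsupp hg.finsupp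
  total := by
    simp_rw [step_eq_sum a f hg.finsupp]
    rw [tsum_sum_shift a hf.finsupp, ← tsum_eq_sum_support, hf.total, hg.total, one_mul]

theorem isFinProb_walk (a : ℤ) {μ : ℤ → ℝ} (hμ : IsFinProb μ) (n : ℕ) :
    IsFinProb (walk a μ n) := by
  induction n with
  | zero =>
    refine ⟨fun x => ?_, ?_, ?_⟩
    · simp only [walk]; split_ifs <;> norm_num
    · refine (Set.finite_singleton (0 : ℤ)).subset fun x hx => ?_
      by_contra h
      exact hx (if_neg h)
    · simp [walk]
  | succ n ih => exact hμ.step ih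

theorem step_step (a b : ℤ) (μ : ℤ → ℝ) {f g : ℤ → ℝ} (hf : (Function.support f).Finite)
    (hg : (Function.support g).Finite) :
    step a μ (step b f g) = step (a * b) (step a μ f) g := by
  funext x
  rw [step_eq_sum _ _ hg, step]
  simp_rw [step_eq_sum b f hg, Finset.mul_sum, step, ← tsum_mul_right]
  rw [Summable.tsum_finsetSum]
  · refine Finset.sum_congr rfl fun z _ => ?_
    rw [← tsum_shift (fun y => μ (x - a * b * z - a * y) * f y * g z) (b * z)]
    refine tsum_congr fun y => ?_
    rw [show x - a * b * z - a * (y - b * z) = x - a * y by ring]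
    ring
  · intro z _
    refine summable_of_hasFiniteSupport ((finite_support_shift hf (b * z)).subset fun y hy => ?_)
    exact left_ne_zero_of_mul (right_ne_zero_of_mul hy)

theorem walk_add (a : ℤ) {μ : ℤ → ℝ} (hμ : IsFinProb μ) (m n : ℕ) :
    walk a μ (m + n) = step (a ^ m) (walk a μ m) (walk a μ n) := by
  induction m with
  | zero =>
    funext x
    rw [step, tsum_eq_single x]
    · simp [walk]
    · intro y hy
      have : x - y ≠ 0 := sub_ne_zero.mpr hy.symm
      simp [walk, this]
  | succ m ih =>
    rw [Nat.succ_add, walk, ih, step_step _ _ _ (isFinProb_walk a hμ m).finsupp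
      (isFinProb_walk a hμ n).finsupp, walk, pow_succ']

theorem sum_rpow_le {ι : Type*} {s : ℝ} (hs : 0 < s) (hs1 : s ≤ 1) (G : Finset ι) {u : ι → ℝ}
    (hu : ∀ i, 0 ≤ u i) : (∑ i ∈ G, u i) ^ s ≤ ∑ i ∈ G, u i ^ s := by
  induction G using Finset.cons_induction with
  | empty => simp [Real.zero_rpow hs.ne']
  | cons i G hi ih =>
    rw [Finset.sum_cons, Finset.sum_cons]
    exact (Real.rpow_add_le_add_rpow (hu i) (Finset.sum_nonneg fun i _ => hu i) hs.le hs1).trans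
      (by gcongr)

theorem finite_support_rpow {s : ℝ} (hs : 0 < s) {f : ℤ → ℝ} (hf : (Function.support f).Finite) :
    (Function.support fun x => f x ^ s).Finite := by
  refine hf.subset fun x hx h => hx ?_
  simp only [h]
  exact Real.zero_rpow hs.ne'

theorem powerSum_eq_sum {s : ℝ} (hs : 0 < s) {f : ℤ → ℝ} (hf : (Function.support f).Finite) :
    powerSum s f = ∑ x ∈ hf.toFinset, f x ^ s := by
  refine tsum_eq_sum fun x hx => ?_
  have : f x = 0 := by simpa using hx
  rw [this, Real.zero_rpow hs.ne']

theorem powerSum_nonneg (s : ℝ) {f : ℤ → ℝ} (hf : ∀ x, 0 ≤ f x) : 0 ≤ powerSum s f :=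
  tsum_nonneg fun x => Real.rpow_nonneg (hf x) s

theorem powerSum_step_le {s : ℝ} (hs : 0 < s) (hs1 : s ≤ 1) (a : ℤ) {f g : ℤ → ℝ}
    (hf : IsFinProb f) (hg : IsFinProb g) :
    powerSum s (step a f g) ≤ powerSum s f * powerSum s g := by
  rw [powerSum_eq_sum hs hg.finsupp, powerSum, powerSum,
    ← tsum_sum_shift a (finite_support_rpow hs hf.finsupp)]
  refine Summable.tsum_le_tsum (fun x => ?_)
    (summable_of_hasFiniteSupport (finite_support_rpow hs (hf.step hg).finsupp))
    (summable_sum fun y _ => (summable_of_hasFiniteSupport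
      (finite_support_shift (finite_support_rpow hs hf.finsupp) (a * y))).mul_right _)
  rw [step_eq_sum a f hg.finsupp]
  refine (sum_rpow_le hs hs1 _ fun y => mul_nonneg (hf.nonneg _) (hg.nonneg _)).trans_eq ?_
  exact Finset.sum_congr rfl fun y _ => Real.mul_rpow (hf.nonneg _) (hg.nonneg _)

theorem powerSum_walk_mul_le {s : ℝ} (hs : 0 < s) (hs1 : s ≤ 1) (a : ℤ) {μ : ℤ → ℝ}
    (hμ : IsFinProb μ) (m r k : ℕ) :
    powerSum s (walk a μ (m * k + r)) ≤ powerSum s (walk a μ m) ^ k * powerSum s (walk a μ r) := by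
  induction k with
  | zero => simp
  | succ k ih =>
    rw [show m * (k + 1) + r = m + (m * k + r) by ring, walk_add a hμ]
    refine (powerSum_step_le hs hs1 _ (isFinProb_walk a hμ _) (isFinProb_walk a hμ _)).trans ?_
    refine (mul_le_mul_of_nonneg_left ih
      (powerSum_nonneg s (isFinProb_walk a hμ m).nonneg)).trans_eq ?_
    ring

theorem exists_powerSum_walk_le {s κ : ℝ} (hs : 0 < s) (hs1 : s ≤ 1) (hκ : 0 ≤ κ) (a : ℤ)
    {μ : ℤ → ℝ} (hμ : IsFinProb μ) {m : ℕ} (hm : 0 < m)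
    (h : powerSum s (walk a μ m) ≤ Real.exp (κ * m)) :
    ∃ C : ℝ, 0 ≤ C ∧ ∀ n : ℕ, powerSum s (walk a μ n) ≤ C * Real.exp (κ * n) := by
  have h0 : ∀ n, 0 ≤ powerSum s (walk a μ n) :=
    fun n => powerSum_nonneg s (isFinProb_walk a hμ n).nonneg
  have hC : 0 ≤ ∑ r ∈ Finset.range m, powerSum s (walk a μ r) := Finset.sum_nonneg fun r _ => h0 r
  refine ⟨_, hC, fun n => ?_⟩
  have hr : powerSum s (walk a μ (n % m)) ≤ ∑ r ∈ Finset.range m, powerSum s (walk a μ r) :=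
    Finset.single_le_sum (f := fun r => powerSum s (walk a μ r)) (fun r _ => h0 r)
      (Finset.mem_range.2 (Nat.mod_lt n hm))
  have hk : powerSum s (walk a μ m) ^ (n / m) ≤ Real.exp (κ * n) := by
    refine (pow_le_pow_left₀ (h0 m) h _).trans ?_
    rw [← Real.exp_nat_mul, Real.exp_le_exp]
    have : ((m * (n / m) : ℕ) : ℝ) ≤ n := by exact_mod_cast Nat.mul_div_le n m
    push_cast at this
    nlinarith
  have := powerSum_walk_mul_le hs hs1 a hμ m (n % m) (n / m)
  rw [Nat.div_add_mod] at this
  refine this.trans ?_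
  rw [mul_comm]
  exact mul_le_mul hr hk (pow_nonneg (h0 m) _) hC

theorem entropy_eq_sum {f : ℤ → ℝ} (hf : (Function.support f).Finite) :
    entropy f = -∑ x ∈ hf.toFinset, f x * Real.log (f x) := by
  rw [entropy, tsum_eq_sum]
  intro x hx
  have : f x = 0 := by simpa using hx
  simp [this]

/-- Near `s = 1` the Rényi entropy is controlled by the Shannon entropy. -/
theorem IsFinProb.exists_powerSum_le {f : ℤ → ℝ} (hf : IsFinProb f) {E : ℝ}
    (hE : entropy f < E) :
    ∃ s : ℝ, 0 < s ∧ s < 1 ∧ powerSum s f ≤ Real.exp ((1 - s) * E) := by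
  set F := hf.finsupp.toFinset
  let g : ℝ → ℝ := fun s => ∑ x ∈ F, f x ^ s - Real.exp ((1 - s) * E)
  have hpos : ∀ x ∈ F, 0 < f x := fun x hx =>
    lt_of_le_of_ne (hf.nonneg x) (Ne.symm (by simpa [F] using hx))
  have hg : HasDerivAt g (-entropy f + E) 1 := by
    have h1 : HasDerivAt (fun s : ℝ => ∑ x ∈ F, f x ^ s)
        (∑ x ∈ F, f x ^ (1 : ℝ) * Real.log (f x)) 1 :=
      HasDerivAt.fun_sum fun x hx => (Real.hasStrictDerivAt_const_rpow (hpos x hx) 1).hasDerivAt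
    have h2 : HasDerivAt (fun s : ℝ => Real.exp ((1 - s) * E))
        (Real.exp ((1 - 1) * E) * (-1 * E)) 1 :=
      (((hasDerivAt_id (1 : ℝ)).const_sub 1).mul_const E).exp
    have h3 : -entropy f + E = ∑ x ∈ F, f x ^ (1 : ℝ) * Real.log (f x)
        - Real.exp ((1 - 1) * E) * (-1 * E) := by
      simp [entropy_eq_sum hf.finsupp, F]
    rw [h3]
    exact h1.fun_sub h2
  have hg0 : g 1 = 0 := by
    have h1 : ∑ x ∈ F, f x = 1 := by rw [← tsum_eq_sum_support hf.finsupp, hf.total]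
    simp [g, h1]
  have hsign := eventually_nhdsWithin_sign_eq_of_deriv_pos
    (by rw [hg.deriv]; linarith) hg0
  have hlt : ∀ᶠ s in nhdsWithin (1 : ℝ) (Set.Iio 1), 0 < s ∧ s < 1 :=
    Ioo_mem_nhdsLT one_pos
  obtain ⟨s, hs, h0, h1⟩ := ((hsign.filter_mono nhdsWithin_le_nhds).and hlt).exists
  refine ⟨s, h0, h1, ?_⟩
  rw [sign_neg (sub_neg.2 h1), sign_eq_neg_one_iff] at hs
  rw [powerSum_eq_sum h0 hf.finsupp]
  exact (sub_neg.1 hs).le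

theorem modq_eq_sum (q : ℕ) {f : ℤ → ℝ} (hf : (Function.support f).Finite) (x : ZMod q) :
    modq q f x = ∑ y ∈ hf.toFinset with ((y : ℤ) : ZMod q) = x, f y := by
  rw [modq, Finset.sum_filter]
  refine tsum_eq_sum fun y hy => ?_
  have : f y = 0 := by simpa using hy
  simp [this]

theorem one_sub_le_distUnif (q : ℕ) [NeZero q] {f : ℤ → ℝ} (hf : IsFinProb f) {s : ℝ}
    (hs : 0 < s) (hs1 : s < 1) :
    1 - (1 / q : ℝ) ^ (1 - s) * powerSum s f ≤ (1 / 2) * distUnif q f := by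
  have hq : (0 : ℝ) < q := by exact_mod_cast Nat.pos_of_ne_zero (NeZero.ne q)
  have hν : ∀ x, 0 ≤ modq q f x := fun x => by
    rw [modq_eq_sum q hf.finsupp]; exact Finset.sum_nonneg fun y _ => hf.nonneg y
  have htot : ∑ x, modq q f x = 1 := by
    simp_rw [modq_eq_sum q hf.finsupp]
    rw [Finset.sum_fiberwise, ← tsum_eq_sum_support, hf.total]
  have hunif : ∑ _x : ZMod q, (1 / q : ℝ) = 1 := by
    simp [ZMod.card, hq.ne']
  have hpow : ∑ x, modq q f x ^ s ≤ powerSum s f := by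
    rw [powerSum_eq_sum hs hf.finsupp,
      ← Finset.sum_fiberwise hf.finsupp.toFinset (fun y : ℤ => (y : ZMod q))]
    refine Finset.sum_le_sum fun x _ => ?_
    rw [modq_eq_sum q hf.finsupp]
    exact sum_rpow_le hs hs1.le _ hf.nonneg
  have hmin : ∀ x, min (modq q f x) (1 / q) ≤ modq q f x ^ s * (1 / q : ℝ) ^ (1 - s) := by
    intro x
    have h0 : 0 ≤ min (modq q f x) (1 / q : ℝ) := le_min (hν x) (by positivity)
    calc min (modq q f x) (1 / q : ℝ)
        = min (modq q f x) (1 / q : ℝ) ^ s * min (modq q f x) (1 / q : ℝ) ^ (1 - s) := by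
          rw [← Real.rpow_add_of_nonneg h0 hs.le (by linarith), add_sub_cancel, Real.rpow_one]
      _ ≤ _ := mul_le_mul (Real.rpow_le_rpow h0 (min_le_left _ _) hs.le)
          (Real.rpow_le_rpow h0 (min_le_right _ _) (by linarith))
          (Real.rpow_nonneg h0 _) (Real.rpow_nonneg (hν x) _)
  have habs : ∀ x, |modq q f x - 1 / q| = modq q f x + 1 / q - 2 * min (modq q f x) (1 / q) := by
    intro x
    rcases le_total (modq q f x) (1 / q) with h | h
    · rw [min_eq_left h, abs_of_nonpos (by linarith)]; ring
    · rw [min_eq_right h, abs_of_nonneg (by linarith)]; ring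
  have hdist : distUnif q f = 2 - 2 * ∑ x, min (modq q f x) (1 / q) := by
    rw [distUnif, tsum_fintype]
    simp_rw [habs]
    rw [Finset.sum_sub_distrib, Finset.sum_add_distrib, htot, hunif, ← Finset.mul_sum]
    norm_num
  have hsum : ∑ x, min (modq q f x) (1 / q) ≤ (1 / q : ℝ) ^ (1 - s) * powerSum s f := by
    refine (Finset.sum_le_sum fun x _ => hmin x).trans ?_
    rw [← Finset.sum_mul, mul_comm]
    gcongr
  rw [hdist]
  linarith

/-- No residue class modulo `a` carries all the mass of `μ`. -/
theorem IsGoodMeasure.exists_tsum_residue_le {a : ℤ} (ha : 1 < a) {μ : ℤ → ℝ}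
    (hμ : IsGoodMeasure μ) :
    ∃ c : ℝ, 0 < c ∧ c < 1 ∧ ∀ x : ℤ, ∑' y : ℤ, μ (x - a * y) ≤ c := by
  have hpos : ∀ z ∈ hμ.finsupp.toFinset, 0 < μ z := fun z hz =>
    lt_of_le_of_ne (hμ.nonneg z) (Ne.symm (by simpa using hz))
  have hne : hμ.finsupp.toFinset.Nonempty := by
    rw [Finset.nonempty_iff_ne_empty]
    intro h
    have := hμ.total
    rw [tsum_eq_sum_support hμ.finsupp, h] at this
    simp at this
  obtain ⟨z₀, hz₀, hmin⟩ := Finset.exists_min_image hμ.finsupp.toFinset μ hne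
  refine ⟨max (1 / 2) (1 - μ z₀), by positivity,
    max_lt (by norm_num) (by linarith [hpos z₀ hz₀]), fun x => le_max_of_le_right ?_⟩
  obtain ⟨z, hz, hzx⟩ : ∃ z ∈ hμ.finsupp.toFinset, ¬ a ∣ x - z := by
    by_contra! h
    have := hμ.gcd_one a fun u hu v hv => by
      have h1 := h u (by simpa using hu)
      have h2 := h v (by simpa using hv)
      simpa using dvd_sub h2 h1
    rcases Int.isUnit_iff.1 this with h | h <;> omega
  have hinj : Function.Injective fun y : ℤ => x - a * y := by
    intro y y' h
    have : a * y = a * y' := by simpa using h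
    exact mul_left_cancel₀ (by omega) this
  have hsμ : Summable μ := summable_of_hasFiniteSupport hμ.finsupp
  have hle : ∑' y : ℤ, μ (x - a * y) ≤ ∑' w, if w = z then 0 else μ w := by
    have hsum : Summable fun w => if w = z then 0 else μ w := by
      refine hsμ.of_nonneg_of_le (fun w => ?_) fun w => ?_ <;> split_ifs <;>
        first | exact le_rfl | exact hμ.nonneg _
    refine Summable.tsum_le_tsum_of_inj _ hinj (fun w _ => ?_) (fun y => ?_)
      (hsμ.comp_injective hinj) hsum
    · split_ifs
      exacts [le_rfl, hμ.nonneg _]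
    · rw [if_neg]
      rintro rfl
      exact hzx ⟨y, by ring⟩
  have := hsμ.tsum_eq_add_tsum_ite z
  rw [hμ.total] at this
  linarith [hmin z hz]

theorem walk_le_pow {a : ℤ} {μ : ℤ → ℝ} (hμ : IsFinProb μ) {c : ℝ} (ha : a ≠ 0)
    (hc : 0 < c) (h : ∀ x : ℤ, ∑' y : ℤ, μ (x - a * y) ≤ c) (n : ℕ) (x : ℤ) :
    walk a μ n x ≤ c ^ n := by
  induction n generalizing x with
  | zero => simp only [walk]; split_ifs <;> simp
  | succ n ih =>
    have hinj : Function.Injective fun y : ℤ => x - a * y := by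
      intro y y' h
      have : a * y = a * y' := by simpa using h
      exact mul_left_cancel₀ ha this
    have hs : Summable fun y => μ (x - a * y) * c ^ n :=
      ((summable_of_hasFiniteSupport hμ.finsupp).comp_injective hinj).mul_right _
    have hle : ∀ y, μ (x - a * y) * walk a μ n y ≤ μ (x - a * y) * c ^ n :=
      fun y => mul_le_mul_of_nonneg_left (ih y) (hμ.nonneg _)
    calc walk a μ (n + 1) x ≤ ∑' y, μ (x - a * y) * c ^ n :=
          Summable.tsum_le_tsum hle (hs.of_nonneg_of_le
            (fun y => mul_nonneg (hμ.nonneg _) ((isFinProb_walk a hμ n).nonneg y)) hle) hs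
      _ ≤ c * c ^ n := by
          rw [tsum_mul_right]
          exact mul_le_mul_of_nonneg_right (h x) (by positivity)
      _ = c ^ (n + 1) := by ring

theorem IsFinProb.neg_log_le_entropy {f : ℤ → ℝ} (hf : IsFinProb f) {M : ℝ}
    (hM : ∀ x, f x ≤ M) : -Real.log M ≤ entropy f := by
  have htot := hf.total
  rw [tsum_eq_sum_support hf.finsupp] at htot
  rw [entropy_eq_sum hf.finsupp, neg_le_neg_iff, ← one_mul (Real.log M), ← htot, Finset.sum_mul]
  refine Finset.sum_le_sum fun x hx => ?_
  have hpos : 0 < f x := lt_of_le_of_ne (hf.nonneg x) (Ne.symm (by simpa using hx))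
  exact mul_le_mul_of_nonneg_left (Real.log_le_log hpos (hM x)) hpos.le

theorem asymptotic_entropy_pos {a : ℤ} (ha : 1 < a) {μ : ℤ → ℝ} (hμ : IsGoodMeasure μ) {H : ℝ}
    (hH : Filter.Tendsto (fun n : ℕ => entropy (walk a μ n) / n) Filter.atTop (nhds H)) :
    0 < H := by
  obtain ⟨c, hc0, hc1, hc⟩ := hμ.exists_tsum_residue_le ha
  refine (neg_pos.2 (Real.log_neg hc0 hc1)).trans_le (ge_of_tendsto hH ?_)
  filter_upwards [Filter.eventually_gt_atTop 0] with n hn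
  have hn' : (0 : ℝ) < n := by exact_mod_cast hn
  have := (isFinProb_walk a hμ.isFinProb n).neg_log_le_entropy
    (walk_le_pow hμ.isFinProb (by omega) hc0 hc n)
  rw [Real.log_pow] at this
  rw [le_div_iff₀ hn']
  linarith

/-- for every `δ, ε > 0` there is `Q₀` such that for every `q ≥ Q₀` and every
`n ≥ 1` with `H·n ≤ (1−δ)·log q`, one has `(1/2)·‖μ_n mod q − u_q‖ ≥ 1 − ε`. -/
theorem stmt0 (a : ℤ) (ha : 1 < a) (μ : ℤ → ℝ) (hμ : IsGoodMeasure μ) (H : ℝ)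
    (hH : Filter.Tendsto (fun n : ℕ => entropy (walk a μ n) / n) Filter.atTop (nhds H))
    (δ ε : ℝ) (hδ : 0 < δ) (hε : 0 < ε) :
    ∃ Q₀ : ℕ, ∀ q : ℕ, Q₀ ≤ q → ∀ n : ℕ, 1 ≤ n →
      H * n ≤ (1 - δ) * Real.log q →
      1 - ε ≤ (1 / 2) * distUnif q (walk a μ n) := by
  have hHpos := asymptotic_entropy_pos ha hμ hH
  have hP := hμ.isFinProb
  obtain ⟨m, hm, hm0⟩ := ((hH.eventually (gt_mem_nhds
    (show H < H * (1 + δ / 2) by nlinarith [mul_pos hHpos hδ]))).and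
      (Filter.eventually_gt_atTop 0)).exists
  have hm' : (0 : ℝ) < m := by exact_mod_cast hm0
  rw [div_lt_iff₀ hm'] at hm
  obtain ⟨s, hs0, hs1, hs⟩ := (isFinProb_walk a hP m).exists_powerSum_le hm
  have hs2 : 0 < 1 - s := by linarith
  obtain ⟨C, hC, hbound⟩ := exists_powerSum_walk_le (κ := (1 - s) * (H * (1 + δ / 2))) hs0 hs1.le
    (by positivity) a hP hm0 (hs.trans_eq (by ring_nf))
  have hlim : Filter.Tendsto (fun q : ℕ => C * Real.exp (-((1 - s) * (δ / 2)) * Real.log q))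
      Filter.atTop (nhds 0) := by
    rw [← mul_zero C]
    refine (Real.tendsto_exp_atBot.comp (Filter.Tendsto.const_mul_atTop_of_neg ?_
      (Real.tendsto_log_atTop.comp tendsto_natCast_atTop_atTop))).const_mul C
    have : 0 < (1 - s) * (δ / 2) := by positivity
    linarith
  obtain ⟨Q, hQ⟩ := Filter.eventually_atTop.1
    ((hlim.eventually (gt_mem_nhds hε)).and (Filter.eventually_ge_atTop 1))
  refine ⟨Q, fun q hq n _ hn => ?_⟩
  obtain ⟨hqε, hq1⟩ := hQ q hq
  have : NeZero q := ⟨by omega⟩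
  have hq0 : (0 : ℝ) < q := by exact_mod_cast hq1
  have hlog : 0 ≤ Real.log q := Real.log_nonneg (by exact_mod_cast hq1)
  refine le_trans ?_ (one_sub_le_distUnif q (isFinProb_walk a hP n) hs0 hs1)
  have hexp : (1 / q : ℝ) ^ (1 - s) = Real.exp (-(1 - s) * Real.log q) := by
    rw [Real.rpow_def_of_pos (by positivity), one_div, Real.log_inv]
    ring_nf
  have hkey : H * (1 + δ / 2) * n - Real.log q ≤ -(δ / 2) * Real.log q := by
    have := mul_le_mul_of_nonneg_right hn (show 0 ≤ 1 + δ / 2 by positivity)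
    nlinarith [mul_nonneg (mul_nonneg hδ.le hδ.le) hlog]
  have : (1 / q : ℝ) ^ (1 - s) * powerSum s (walk a μ n)
      ≤ C * Real.exp (-((1 - s) * (δ / 2)) * Real.log q) := by
    rw [hexp]
    calc Real.exp (-(1 - s) * Real.log q) * powerSum s (walk a μ n)
        ≤ Real.exp (-(1 - s) * Real.log q)
          * (C * Real.exp ((1 - s) * (H * (1 + δ / 2)) * n)) := by
          gcongr
          exact hbound n
      _ = C * Real.exp ((1 - s) * (H * (1 + δ / 2) * n - Real.log q)) := by
          rw [mul_left_comm, ← Real.exp_add]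
          ring_nf
      _ ≤ _ := by
          refine mul_le_mul_of_nonneg_left (Real.exp_le_exp.2 ?_) hC
          linarith [mul_le_mul_of_nonneg_left hkey hs2.le]
  linarith
end

section
/- There is a constant C depending only on a and μ such that for all n ≥ 1 and all α > 0: μ_n({x ∈ ℤ : |−log μ_n({x}) − H(μ_n)| ≥ α·n}) ≤ C/(α²·n). -/
open scoped Classical

section Word

variable {ι : Type*}

/-- The weight of a word under the product measure. -/
noncomputable def wordWeight (m : ι → ℝ) {n : ℕ} (ω : Fin n → ι) : ℝ := ∏ i, m (ω i)

theorem wordWeight_cons (m : ι → ℝ) {n : ℕ} (b : ι) (ω : Fin n → ι) :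
    wordWeight m (Fin.cons b ω : Fin (n + 1) → ι) = m b * wordWeight m ω := by
  simp [wordWeight, Fin.prod_univ_succ]

theorem wordWeight_update_mul (m : ι → ℝ) {n : ℕ} (ω : Fin n → ι) (i : Fin n) (c : ι) :
    wordWeight m (Function.update ω i c) * m (ω i) = wordWeight m ω * m c := by
  have h : ∀ η : Fin n → ι, wordWeight m η = m (η i) * ∏ j ∈ Finset.univ.erase i, m (η j) :=
    fun η => (Finset.mul_prod_erase _ _ (Finset.mem_univ i)).symm
  rw [h, h ω, Function.update_self]
  have : ∏ j ∈ Finset.univ.erase i, m (Function.update ω i c j)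
      = ∏ j ∈ Finset.univ.erase i, m (ω j) :=
    Finset.prod_congr rfl fun j hj => by
      rw [Function.update_of_ne (Finset.ne_of_mem_erase hj)]
  rw [this]
  ring

/-- The integer with base-`a` digits `v (ω 0), v (ω 1), …`, least significant first. -/
def wordValue (a : ℤ) (v : ι → ℤ) {n : ℕ} (ω : Fin n → ι) : ℤ := ∑ i : Fin n, a ^ (i : ℕ) * v (ω i)

theorem wordValue_cons (a : ℤ) (v : ι → ℤ) {n : ℕ} (b : ι) (ω : Fin n → ι) :
    wordValue a v (Fin.cons b ω : Fin (n + 1) → ι) = v b + a * wordValue a v ω := by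
  simp [wordValue, Fin.sum_univ_succ, Finset.mul_sum, pow_succ', mul_assoc]

theorem wordValue_update (a : ℤ) (v : ι → ℤ) {n : ℕ} (ω : Fin n → ι) (i : Fin n) (c : ι) :
    wordValue a v (Function.update ω i c)
      = wordValue a v ω + a ^ (i : ℕ) * (v c - v (ω i)) := by
  have h : ∀ η : Fin n → ι, wordValue a v η = a ^ (i : ℕ) * v (η i)
      + ∑ j ∈ Finset.univ.erase i, a ^ (j : ℕ) * v (η j) :=
    fun η => (Finset.add_sum_erase _ _ (Finset.mem_univ i)).symm
  rw [h, h ω, Function.update_self]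
  have : ∑ j ∈ Finset.univ.erase i, a ^ (j : ℕ) * v (Function.update ω i c j)
      = ∑ j ∈ Finset.univ.erase i, a ^ (j : ℕ) * v (ω j) :=
    Finset.sum_congr rfl fun j hj => by
      rw [Function.update_of_ne (Finset.ne_of_mem_erase hj)]
  rw [this]
  ring

end Word

section EfronStein

variable {ι : Type*} [Fintype ι]

/-- Jensen's inequality for the square, with finitely many weights. -/
theorem sq_sum_weight_le {κ : Type*} [Fintype κ] (P : κ → ℝ) (hP : ∀ k, 0 ≤ P k)
    (hP1 : ∑ k, P k = 1) (g : κ → ℝ) : (∑ k, P k * g k) ^ 2 ≤ ∑ k, P k * g k ^ 2 := by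
  have h := (even_two.convexOn_pow (𝕜 := ℝ)).map_sum_le (t := Finset.univ) (w := P) (p := g)
    (fun k _ => hP k) hP1 (fun k _ => Set.mem_univ _)
  simpa [smul_eq_mul] using h

theorem two_mul_variance_eq (m : ι → ℝ) (hm1 : ∑ b, m b = 1) (g : ι → ℝ) :
    2 * (∑ b, m b * g b ^ 2 - (∑ b, m b * g b) ^ 2)
      = ∑ b, ∑ c, m b * m c * (g b - g c) ^ 2 := by
  have h : ∀ b c, m b * m c * (g b - g c) ^ 2
      = (m b * g b ^ 2) * m c - 2 * ((m b * g b) * (m c * g c)) + m b * (m c * g c ^ 2) := by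
    intros; ring
  simp only [h, Finset.sum_add_distrib, Finset.sum_sub_distrib, ← Finset.mul_sum,
    ← Finset.sum_mul, hm1]
  ring

theorem sum_word_succ {n : ℕ} (F : (Fin (n + 1) → ι) → ℝ) :
    ∑ ω, F ω = ∑ b, ∑ ω : Fin n → ι, F (Fin.cons b ω) := by
  rw [← Fintype.sum_prod_type', ← (Fin.consEquiv fun _ : Fin (n + 1) => ι).sum_comp]
  rfl

theorem sum_wordWeight (m : ι → ℝ) (hm1 : ∑ b, m b = 1) (n : ℕ) :
    ∑ ω : Fin n → ι, wordWeight m ω = 1 := by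
  induction n with
  | zero => simp [wordWeight]
  | succ n ih => simp [sum_word_succ, wordWeight_cons, ← Finset.mul_sum, ih, hm1]

/-- The Efron–Stein inequality for a finite product of copies of a finite probability space. -/
theorem efron_stein (m : ι → ℝ) (hm : ∀ b, 0 ≤ m b) (hm1 : ∑ b, m b = 1) (n : ℕ)
    (f : (Fin n → ι) → ℝ) :
    2 * (∑ ω, wordWeight m ω * f ω ^ 2 - (∑ ω, wordWeight m ω * f ω) ^ 2)
      ≤ ∑ i, ∑ ω, ∑ c, wordWeight m ω * m c * (f ω - f (Function.update ω i c)) ^ 2 := by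
  induction n with
  | zero => simp [wordWeight]
  | succ n ih =>
    have hP : ∀ ω : Fin n → ι, 0 ≤ wordWeight m ω :=
      fun ω => Finset.prod_nonneg fun _ _ => hm _
    set G : ι → ℝ := fun b => ∑ ω, wordWeight m ω * f (Fin.cons b ω) with hG
    have hvar := two_mul_variance_eq m hm1 G
    have hfst : ∑ b, ∑ c, m b * m c * (G b - G c) ^ 2
        ≤ ∑ ω, ∑ c, wordWeight m ω * m c * (f ω - f (Function.update ω 0 c)) ^ 2 := by
      rw [sum_word_succ]
      simp only [wordWeight_cons, Fin.update_cons_zero]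
      refine Finset.sum_le_sum fun b _ => ?_
      rw [Finset.sum_comm]
      refine Finset.sum_le_sum fun c _ => ?_
      have hj := sq_sum_weight_le (wordWeight m) hP (sum_wordWeight m hm1 n)
        (fun ω => f (Fin.cons b ω) - f (Fin.cons c ω))
      have hsub : ∑ ω, wordWeight m ω * (f (Fin.cons b ω) - f (Fin.cons c ω)) = G b - G c := by
        simp only [hG, mul_sub, Finset.sum_sub_distrib]
      rw [hsub] at hj
      refine (mul_le_mul_of_nonneg_left hj (mul_nonneg (hm b) (hm c))).trans_eq ?_
      rw [Finset.mul_sum]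
      exact Finset.sum_congr rfl fun ω _ => by ring
    have hrest : 2 * ∑ b, m b * (∑ ω, wordWeight m ω * f (Fin.cons b ω) ^ 2 - G b ^ 2)
        ≤ ∑ i : Fin n, ∑ ω, ∑ c, wordWeight m ω * m c *
            (f ω - f (Function.update ω i.succ c)) ^ 2 := by
      simp only [sum_word_succ, wordWeight_cons, ← Fin.cons_update]
      rw [Finset.sum_comm, Finset.mul_sum]
      refine Finset.sum_le_sum fun b _ => ?_
      have h := mul_le_mul_of_nonneg_left (ih fun ω => f (Fin.cons b ω)) (hm b)
      simp only [Finset.mul_sum] at h ⊢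
      refine le_trans (le_of_eq ?_) (h.trans_eq ?_)
      · simp only [hG]; ring
      · refine Finset.sum_congr rfl fun i _ => Finset.sum_congr rfl fun ω _ =>
          Finset.sum_congr rfl fun c _ => by ring
    rw [Fin.sum_univ_succ]
    refine le_trans (le_of_eq ?_) (add_le_add hfst hrest)
    rw [← hvar, sum_word_succ, sum_word_succ]
    simp only [wordWeight_cons, mul_assoc, ← Finset.mul_sum, mul_sub, Finset.sum_sub_distrib, hG]
    ring

/-- Resampling one letter of a word is a reversible operation. -/
theorem sum_resample_symm (m : ι → ℝ) {n : ℕ} (i : Fin n)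
    (K : (Fin n → ι) → (Fin n → ι) → ℝ) :
    ∑ ω, ∑ c, wordWeight m ω * m c * K (Function.update ω i c) ω
      = ∑ ω, ∑ c, wordWeight m ω * m c * K ω (Function.update ω i c) := by
  rw [← Fintype.sum_prod_type', ← Fintype.sum_prod_type']
  have hinv : Function.Involutive
      (fun q : (Fin n → ι) × ι => (Function.update q.1 i q.2, q.1 i)) := by
    rintro ⟨ω, c⟩
    simp
  refine Fintype.sum_equiv hinv.toPerm _ _ ?_
  rintro ⟨ω, c⟩
  simp [wordWeight_update_mul]

end EfronStein

theorem sq_log_le_self {u : ℝ} (hu : 1 ≤ u) : Real.log u ^ 2 ≤ u := by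
  have h0 : 0 < u := by linarith
  have h1 := Real.add_one_le_exp (Real.log u / 2 - 1)
  have h2 : Real.exp (Real.log u / 2 - 1) * Real.exp 1 = √u := by
    rw [← Real.exp_add, Real.sqrt_eq_rpow, Real.rpow_def_of_pos h0]
    congr 1
    ring
  have h3 : (2 : ℝ) ≤ Real.exp 1 := by
    have := Real.add_one_le_exp (1 : ℝ)
    linarith
  have h4 : 0 ≤ Real.log u := Real.log_nonneg hu
  have h5 : Real.log u ≤ √u := by nlinarith [Real.exp_pos (Real.log u / 2 - 1)]
  calc Real.log u ^ 2 ≤ √u ^ 2 := by gcongr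
    _ = u := Real.sq_sqrt h0.le

theorem sq_log_sub_log_le {s t : ℝ} (hs : 0 < s) (ht : 0 < t) :
    (Real.log s - Real.log t) ^ 2 ≤ s / t + t / s := by
  have hst : 0 < s / t := div_pos hs ht
  have hts : 0 < t / s := div_pos ht hs
  rcases le_total t s with h | h
  · have := sq_log_le_self ((one_le_div ht).2 h)
    rw [Real.log_div hs.ne' ht.ne'] at this
    linarith
  · have := sq_log_le_self ((one_le_div hs).2 h)
    rw [Real.log_div ht.ne' hs.ne'] at this
    nlinarith

section WordLaw

variable {ι : Type*} [Fintype ι]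

/-- The law of the value of a random word. -/
noncomputable def wordLaw (a : ℤ) (v : ι → ℤ) (m : ι → ℝ) (n : ℕ) (x : ℤ) : ℝ :=
  ∑ ω : Fin n → ι, if wordValue a v ω = x then wordWeight m ω else 0

theorem hasSum_wordLaw_mul (a : ℤ) (v : ι → ℤ) (m : ι → ℝ) (n : ℕ) (g : ℤ → ℝ) :
    HasSum (fun x => wordLaw a v m n x * g x)
      (∑ ω : Fin n → ι, wordWeight m ω * g (wordValue a v ω)) := by
  simp only [wordLaw, Finset.sum_mul]
  refine hasSum_sum fun ω _ => ?_
  convert hasSum_ite_eq (wordValue a v ω) (wordWeight m ω * g (wordValue a v ω)) using 2 with x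
  by_cases h : wordValue a v ω = x
  · simp [h]
  · simp [h, Ne.symm h]

theorem sum_wordLaw_le_one (a : ℤ) (v : ι → ℤ) (m : ι → ℝ) (hm : ∀ b, 0 ≤ m b)
    (hm1 : ∑ b, m b = 1) (n : ℕ) (s : Finset ℤ) : ∑ x ∈ s, wordLaw a v m n x ≤ 1 := by
  have h := hasSum_wordLaw_mul a v m n 1
  simp only [Pi.one_apply, mul_one, sum_wordWeight m hm1] at h
  refine sum_le_hasSum s (fun x _ => Finset.sum_nonneg fun ω _ => ?_) h
  split_ifs
  · exact Finset.prod_nonneg fun _ _ => hm _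
  · exact le_rfl

theorem wordLaw_wordValue_pos (a : ℤ) (v : ι → ℤ) (m : ι → ℝ) (hm : ∀ b, 0 < m b) {n : ℕ}
    (ω : Fin n → ι) : 0 < wordLaw a v m n (wordValue a v ω) := by
  have hP : ∀ η : Fin n → ι, 0 < wordWeight m η := fun η => Finset.prod_pos fun _ _ => hm _
  refine Finset.sum_pos' (fun η _ => ?_) ⟨ω, Finset.mem_univ _, by simpa using hP ω⟩
  split_ifs
  · exact (hP η).le
  · exact le_rfl

/-- Dividing by the law turns an average over words into a sum over their values. -/
theorem sum_wordWeight_mul_div_wordLaw (a : ℤ) (v : ι → ℤ) (m : ι → ℝ) (hm : ∀ b, 0 < m b)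
    (n : ℕ) (h : ℤ → ℝ) :
    ∑ ω : Fin n → ι, wordWeight m ω * (h (wordValue a v ω) / wordLaw a v m n (wordValue a v ω))
      = ∑ x ∈ Finset.univ.image (wordValue a v (n := n)), h x := by
  rw [← Finset.sum_fiberwise_of_maps_to
    (fun ω _ => Finset.mem_image_of_mem (wordValue a v (n := n)) (Finset.mem_univ ω))]
  refine Finset.sum_congr rfl fun x hx => ?_
  obtain ⟨η, -, rfl⟩ := Finset.mem_image.1 hx
  have hpos := wordLaw_wordValue_pos a v m hm η
  have hfib : ∑ ω : Fin n → ι with wordValue a v ω = wordValue a v η, wordWeight m ω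
      = wordLaw a v m n (wordValue a v η) := by
    rw [Finset.sum_filter, wordLaw]
  rw [Finset.sum_congr rfl (g := fun ω => wordWeight m ω *
    (h (wordValue a v η) / wordLaw a v m n (wordValue a v η)))
    (fun ω hω => by rw [(Finset.mem_filter.1 hω).2]), ← Finset.sum_mul, hfib]
  field_simp

theorem sum_resample_ratio_le (a : ℤ) (v : ι → ℤ) (m : ι → ℝ) (hm : ∀ b, 0 < m b)
    (hm1 : ∑ b, m b = 1) {n : ℕ} (i : Fin n) :
    ∑ ω, ∑ c, wordWeight m ω * m c * (wordLaw a v m n (wordValue a v (Function.update ω i c))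
      / wordLaw a v m n (wordValue a v ω)) ≤ Fintype.card ι := by
  have hP : ∀ η : Fin n → ι, 0 ≤ wordWeight m η :=
    fun η => Finset.prod_nonneg fun _ _ => (hm _).le
  have hL : ∀ x, 0 ≤ wordLaw a v m n x := fun x => Finset.sum_nonneg fun ω _ => by
    split_ifs
    exacts [hP ω, le_rfl]
  rw [Finset.sum_comm]
  have key : ∀ c, ∑ ω : Fin n → ι, wordWeight m ω * m c *
      (wordLaw a v m n (wordValue a v (Function.update ω i c))
        / wordLaw a v m n (wordValue a v ω)) ≤ m c * Fintype.card ι := by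
    intro c
    calc _ ≤ ∑ ω : Fin n → ι, m c * (wordWeight m ω *
          ((∑ b, wordLaw a v m n (wordValue a v ω + a ^ (i : ℕ) * (v c - v b)))
            / wordLaw a v m n (wordValue a v ω))) := by
          refine Finset.sum_le_sum fun ω _ => ?_
          rw [mul_comm (wordWeight m ω), mul_assoc, wordValue_update]
          refine mul_le_mul_of_nonneg_left (mul_le_mul_of_nonneg_left
            (div_le_div_of_nonneg_right ?_ (hL _)) (hP ω)) (hm c).le
          exact Finset.single_le_sum
            (f := fun b => wordLaw a v m n (wordValue a v ω + a ^ (i : ℕ) * (v c - v b)))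
            (fun b _ => hL _) (Finset.mem_univ (ω i))
      _ = m c * ∑ b, ∑ x ∈ Finset.univ.image (wordValue a v (n := n)),
            wordLaw a v m n (x + a ^ (i : ℕ) * (v c - v b)) := by
          rw [← Finset.mul_sum, sum_wordWeight_mul_div_wordLaw a v m hm n
            (fun x => ∑ b, wordLaw a v m n (x + a ^ (i : ℕ) * (v c - v b))), Finset.sum_comm]
      _ ≤ m c * ∑ _b : ι, 1 := by
          refine mul_le_mul_of_nonneg_left (Finset.sum_le_sum fun b _ => ?_) (hm c).le
          have h := sum_wordLaw_le_one a v m (fun b => (hm b).le) hm1 n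
            ((Finset.univ.image (wordValue a v (n := n))).map
              (addRightEmbedding (a ^ (i : ℕ) * (v c - v b))))
          simpa only [Finset.sum_map, addRightEmbedding_apply] using h
      _ = m c * Fintype.card ι := by simp
  refine (Finset.sum_le_sum fun c _ => key c).trans_eq ?_
  rw [← Finset.sum_mul, hm1, one_mul]

/-- The information of a random word value has variance at most linear in its length. -/
theorem variance_log_wordLaw_le (a : ℤ) (v : ι → ℤ) (m : ι → ℝ) (hm : ∀ b, 0 < m b)
    (hm1 : ∑ b, m b = 1) (n : ℕ) :
    ∑ ω : Fin n → ι, wordWeight m ω * Real.log (wordLaw a v m n (wordValue a v ω)) ^ 2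
      - (∑ ω : Fin n → ι, wordWeight m ω * Real.log (wordLaw a v m n (wordValue a v ω))) ^ 2
      ≤ Fintype.card ι * n := by
  have hES := efron_stein m (fun b => (hm b).le) hm1 n
    (fun ω => Real.log (wordLaw a v m n (wordValue a v ω)))
  have key : ∀ i : Fin n, ∑ ω, ∑ c, wordWeight m ω * m c *
      (Real.log (wordLaw a v m n (wordValue a v ω))
        - Real.log (wordLaw a v m n (wordValue a v (Function.update ω i c)))) ^ 2
      ≤ 2 * Fintype.card ι := by
    intro i
    have hr := sum_resample_ratio_le a v m hm hm1 i
    have hs := sum_resample_symm m i (fun ω η =>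
      wordLaw a v m n (wordValue a v η) / wordLaw a v m n (wordValue a v ω))
    calc _ ≤ ∑ ω, ∑ c, wordWeight m ω * m c *
          (wordLaw a v m n (wordValue a v ω)
            / wordLaw a v m n (wordValue a v (Function.update ω i c))
          + wordLaw a v m n (wordValue a v (Function.update ω i c))
            / wordLaw a v m n (wordValue a v ω)) := by
          refine Finset.sum_le_sum fun ω _ => Finset.sum_le_sum fun c _ => ?_
          exact mul_le_mul_of_nonneg_left
            (sq_log_sub_log_le (wordLaw_wordValue_pos a v m hm _)
              (wordLaw_wordValue_pos a v m hm _))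
            (mul_nonneg (Finset.prod_nonneg fun _ _ => (hm _).le) (hm c).le)
      _ ≤ _ := by
          simp only [mul_add, Finset.sum_add_distrib]
          linarith
  have hsum := hES.trans (Finset.sum_le_sum fun i _ => key i)
  simp only [Finset.sum_const, Finset.card_univ, Fintype.card_fin, nsmul_eq_mul] at hsum
  linarith

end WordLaw

theorem walk_eq_wordLaw (a : ℤ) (μ : ℤ → ℝ) (S : Finset ℤ) (hS : ∀ x ∉ S, μ x = 0) (n : ℕ) :
    walk a μ n = wordLaw a (fun b : S => (b : ℤ)) (fun b : S => μ b) n := by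
  induction n with
  | zero =>
    ext x
    simp [walk, wordLaw, wordValue, wordWeight, eq_comm]
  | succ n ih =>
    ext x
    have h := (hasSum_wordLaw_mul a (fun b : S => (b : ℤ)) (fun b : S => μ b) n
      (fun y => μ (x - a * y))).tsum_eq
    simp only [walk, step, ih]
    rw [tsum_congr fun y => mul_comm _ _, h, wordLaw, sum_word_succ, Finset.sum_comm]
    refine Finset.sum_congr rfl fun ω _ => ?_
    simp only [wordValue_cons, wordWeight_cons]
    set y := wordValue a (fun b : S => (b : ℤ)) ω
    have hiff : ∀ b : ℤ, b + a * y = x ↔ b = x - a * y := fun b => eq_sub_iff_add_eq.symm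
    simp only [hiff]
    rw [Finset.sum_coe_sort S (fun b => if b = x - a * y then
      μ b * wordWeight (fun b : S => μ b) ω else 0), Finset.sum_ite_eq']
    split_ifs with hx
    · ring
    · simp [hS _ hx]

/-- Shannon–McMillan–Breiman with rate: there is a constant `C` depending only
on `a` and `μ` such that for all `n ≥ 1` and all `α > 0`,
`μ_n({x : |−log μ_n({x}) − H(μ_n)| ≥ α·n}) ≤ C/(α²·n)`. -/
theorem stmt4 (a : ℤ) (ha : 1 < a) (μ : ℤ → ℝ) (hμ : IsGoodMeasure μ) :
    ∃ C : ℝ, ∀ n : ℕ, 1 ≤ n → ∀ α : ℝ, 0 < α →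
      (∑' x : ℤ,
          if α * n ≤ |(-Real.log (walk a μ n x)) - entropy (walk a μ n)| then walk a μ n x
          else 0)
        ≤ C / (α ^ 2 * n) := by
  have hfin := hμ.finsupp
  set S : Finset ℤ := hfin.toFinset with hSdef
  have hS : ∀ x ∉ S, μ x = 0 := fun x hx => by simpa [hSdef] using hx
  have hm : ∀ b : S, 0 < μ b := fun b =>
    (hμ.nonneg b).lt_of_ne' (hfin.mem_toFinset.1 b.2)
  have hm1 : ∑ b : S, μ b = 1 := by
    rw [Finset.sum_coe_sort S μ, ← hμ.total, tsum_eq_sum hS]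
  refine ⟨Fintype.card S, fun n hn α hα => ?_⟩
  have hvar := variance_log_wordLaw_le a (fun b : S => (b : ℤ)) (fun b : S => μ b) hm hm1 n
  have hsum := hasSum_wordLaw_mul a (fun b : S => (b : ℤ)) (fun b : S => μ b) n
  have hP1 := sum_wordWeight (fun b : S => μ b) hm1 n
  have hP : ∀ ω : Fin n → S, 0 ≤ wordWeight (fun b : S => μ b) ω :=
    fun ω => Finset.prod_nonneg fun _ _ => (hm _).le
  rw [walk_eq_wordLaw a μ S hS n]
  set L := wordLaw a (fun b : S => (b : ℤ)) (fun b : S => μ b) n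
  set W : (Fin n → S) → ℝ := wordWeight (fun b : S => μ b)
  set X : (Fin n → S) → ℤ := wordValue a (fun b : S => (b : ℤ))
  have hH : entropy L = -∑ ω, W ω * Real.log (L (X ω)) := by
    rw [entropy, (hsum fun x => Real.log (L x)).tsum_eq]
  have hdev := (hsum fun x => if α * n ≤ |(-Real.log (L x)) - entropy L| then 1 else 0).tsum_eq
  simp only [mul_ite, mul_one, mul_zero] at hdev
  rw [hdev]
  have hn0 : (0 : ℝ) < n := by exact_mod_cast hn
  have hαn : 0 < α * n := mul_pos hα hn0
  have hcheb : (∑ ω, if α * n ≤ |(-Real.log (L (X ω))) - entropy L| then W ω else 0) * (α * n) ^ 2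
      ≤ ∑ ω, W ω * (-Real.log (L (X ω)) - entropy L) ^ 2 := by
    rw [Finset.sum_mul]
    refine Finset.sum_le_sum fun ω _ => ?_
    split_ifs with h
    · refine mul_le_mul_of_nonneg_left ?_ (hP ω)
      rw [← sq_abs (-Real.log (L (X ω)) - entropy L)]
      gcongr
    · rw [zero_mul]
      exact mul_nonneg (hP ω) (sq_nonneg _)
  have hexp : ∑ ω, W ω * (-Real.log (L (X ω)) - entropy L) ^ 2
      = ∑ ω, W ω * Real.log (L (X ω)) ^ 2 - (∑ ω, W ω * Real.log (L (X ω))) ^ 2 := by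
    have h : ∀ ω, W ω * (-Real.log (L (X ω)) - entropy L) ^ 2 = W ω * Real.log (L (X ω)) ^ 2
        + 2 * entropy L * (W ω * Real.log (L (X ω))) + entropy L ^ 2 * W ω := by
      intro ω; ring
    rw [Finset.sum_congr rfl fun ω _ => h ω]
    simp only [Finset.sum_add_distrib, ← Finset.mul_sum, hP1]
    rw [hH]
    ring
  rw [hexp] at hcheb
  have hle := hcheb.trans hvar
  rw [le_div_iff₀ (by positivity)]
  refine le_of_mul_le_mul_right ?_ hn0
  linarith
end

section
/- There is a constant C depending only on a and μ such that for every n ≥ 1 and every α > 0 with α²·n ≥ 2C there exists a probability measure ν_n on ℤ satisfying: (1) ‖μ_n − ν_n‖ ≤ C/(α²·n); (2) supp ν_n ⊆ supp μ_n; (3) |log ν_n({x}) + H(μ_n)| ≤ C·α·n for every x ∈ supp ν_n. -/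
open scoped Classical

/-! ### The Efron–Stein inequality on a finite product space -/

section EfronStein

variable {ι : Type*}

/-- The weight of `x` under the product of `n` copies of `p`. -/
def prodWeight (p : ι → ℝ) {n : ℕ} (x : Fin n → ι) : ℝ := ∏ i, p (x i)

lemma prodWeight_nonneg {p : ι → ℝ} (hp : ∀ s, 0 ≤ p s) {n : ℕ} (x : Fin n → ι) :
    0 ≤ prodWeight p x :=
  Finset.prod_nonneg fun i _ => hp (x i)

lemma prodWeight_cons (p : ι → ℝ) {n : ℕ} (s : ι) (y : Fin n → ι) :
    prodWeight p (Fin.cons s y : Fin (n + 1) → ι) = p s * prodWeight p y := by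
  simp [prodWeight, Fin.prod_univ_succ]

lemma prodWeight_update_mul (p : ι → ℝ) {n : ℕ} (x : Fin n → ι) (i : Fin n) (t : ι) :
    prodWeight p (Function.update x i t) * p (x i) = prodWeight p x * p t := by
  unfold prodWeight
  rw [← Finset.mul_prod_erase _ _ (Finset.mem_univ i),
    ← Finset.mul_prod_erase _ (fun j => p (x j)) (Finset.mem_univ i)]
  have : ∏ j ∈ Finset.univ.erase i, p (Function.update x i t j)
      = ∏ j ∈ Finset.univ.erase i, p (x j) :=
    Finset.prod_congr rfl fun j hj => by rw [Function.update_of_ne (Finset.ne_of_mem_erase hj)]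
  rw [this, Function.update_self]
  ring

variable [Fintype ι]

lemma sum_cons {n : ℕ} (F : (Fin (n + 1) → ι) → ℝ) :
    ∑ x, F x = ∑ s, ∑ y, F (Fin.cons s y) := by
  rw [← (Fin.consEquiv fun _ : Fin (n + 1) => ι).sum_comp F, Fintype.sum_prod_type]
  rfl

lemma sum_prodWeight {p : ι → ℝ} (hp1 : ∑ s, p s = 1) (n : ℕ) :
    ∑ x : Fin n → ι, prodWeight p x = 1 := by
  have h := Finset.prod_univ_sum (fun _ : Fin n => (Finset.univ : Finset ι)) fun _ s => p s
  simpa [hp1, prodWeight] using h.symm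

/-- The resampling of the `i`-th coordinate is reversible. -/
lemma sum_resample_swap (p : ι → ℝ) {n : ℕ} (i : Fin n) (F : (Fin n → ι) → (Fin n → ι) → ℝ) :
    ∑ x, ∑ t, prodWeight p x * p t * F x (Function.update x i t)
      = ∑ x, ∑ t, prodWeight p x * p t * F (Function.update x i t) x := by
  rw [← Fintype.sum_prod_type', ← Fintype.sum_prod_type']
  refine Finset.sum_nbij' (fun q => (Function.update q.1 i q.2, q.1 i))
    (fun q => (Function.update q.1 i q.2, q.1 i)) ?_ ?_ ?_ ?_ ?_
  · simp
  · simp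
  · simp
  · simp
  · rintro ⟨x, t⟩ -
    simp [prodWeight_update_mul]

lemma sq_sum_mul_le {p : ι → ℝ} (hp : ∀ s, 0 ≤ p s) (hp1 : ∑ s, p s = 1) (g : ι → ℝ) :
    (∑ s, p s * g s) ^ 2 ≤ ∑ s, p s * g s ^ 2 :=
  Real.pow_arith_mean_le_arith_mean_pow_of_even Finset.univ p g (fun s _ => hp s) hp1 even_two

lemma variance_eq_half_sum {p : ι → ℝ} (hp1 : ∑ s, p s = 1) (g : ι → ℝ) :
    ∑ s, p s * g s ^ 2 - (∑ s, p s * g s) ^ 2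
      = 1 / 2 * ∑ s, ∑ t, p s * p t * (g s - g t) ^ 2 := by
  have h : ∀ s, ∑ t, p s * p t * (g s - g t) ^ 2
      = p s * g s ^ 2 * ∑ t, p t - 2 * (p s * g s) * ∑ t, p t * g t
        + p s * ∑ t, p t * g t ^ 2 := by
    intro s
    simp only [Finset.mul_sum, ← Finset.sum_sub_distrib, ← Finset.sum_add_distrib]
    exact Finset.sum_congr rfl fun t _ => by ring
  simp only [h, Finset.sum_add_distrib, Finset.sum_sub_distrib, ← Finset.sum_mul, hp1,
    ← Finset.mul_sum]
  ring

/-- **Efron–Stein inequality**: the variance of a function of `n` independent variables is at most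
half the sum of the mean squared changes under resampling one coordinate. -/
lemma efron_stein_s8 {p : ι → ℝ} (hp : ∀ s, 0 ≤ p s) (hp1 : ∑ s, p s = 1) (n : ℕ) :
    ∀ f : (Fin n → ι) → ℝ,
      ∑ x, prodWeight p x * f x ^ 2 - (∑ x, prodWeight p x * f x) ^ 2
        ≤ 1 / 2 * ∑ i, ∑ x, ∑ t, prodWeight p x * p t * (f x - f (Function.update x i t)) ^ 2 := by
  induction n with
  | zero => intro f; simp [prodWeight]
  | succ n ih =>
    intro f
    set g : ι → ℝ := fun s => ∑ y, prodWeight p y * f (Fin.cons s y) with hg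
    have hsum : ∀ F : (Fin (n + 1) → ι) → ℝ, ∑ x, prodWeight p x * F x
        = ∑ s, p s * ∑ y, prodWeight p y * F (Fin.cons s y) := by
      intro F
      rw [sum_cons]
      simp only [prodWeight_cons, Finset.mul_sum, mul_assoc]
    have hhead : ∑ s, p s * g s ^ 2 - (∑ s, p s * g s) ^ 2
        ≤ 1 / 2 * ∑ x, ∑ t, prodWeight p x * p t * (f x - f (Function.update x 0 t)) ^ 2 := by
      rw [variance_eq_half_sum hp1, sum_cons]
      refine mul_le_mul_of_nonneg_left (Finset.sum_le_sum fun s _ => ?_) (by norm_num)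
      rw [Finset.sum_comm]
      refine Finset.sum_le_sum fun t _ => ?_
      have h := sq_sum_mul_le (prodWeight_nonneg hp) (sum_prodWeight hp1 n)
        (fun y => f (Fin.cons s y) - f (Fin.cons t y))
      have e : g s - g t = ∑ y, prodWeight p y * (f (Fin.cons s y) - f (Fin.cons t y)) := by
        simp only [hg, mul_sub, Finset.sum_sub_distrib]
      rw [e]
      refine (mul_le_mul_of_nonneg_left h (mul_nonneg (hp s) (hp t))).trans_eq ?_
      rw [Finset.mul_sum]
      refine Finset.sum_congr rfl fun y _ => ?_
      rw [prodWeight_cons, Fin.update_cons_zero]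
      ring
    have htail : ∑ s, p s * (∑ y, prodWeight p y * f (Fin.cons s y) ^ 2 - g s ^ 2)
        ≤ 1 / 2 * ∑ i : Fin n, ∑ x, ∑ t,
          prodWeight p x * p t * (f x - f (Function.update x i.succ t)) ^ 2 := by
      have h := Finset.sum_le_sum fun s (_ : s ∈ Finset.univ) =>
        mul_le_mul_of_nonneg_left (ih fun y => f (Fin.cons s y)) (hp s)
      refine h.trans_eq ?_
      simp only [sum_cons, prodWeight_cons, ← Fin.cons_update, Finset.mul_sum]
      rw [Finset.sum_comm]
      refine Finset.sum_congr rfl fun i _ => Finset.sum_congr rfl fun s _ =>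
        Finset.sum_congr rfl fun y _ => Finset.sum_congr rfl fun t _ => ?_
      ring
    have e : ∑ s, p s * (∑ y, prodWeight p y * f (Fin.cons s y) ^ 2 - g s ^ 2)
        = ∑ x, prodWeight p x * f x ^ 2 - ∑ s, p s * g s ^ 2 := by
      rw [hsum fun x => f x ^ 2]
      simp only [mul_sub, Finset.sum_sub_distrib]
    rw [hsum f, Fin.sum_univ_succ, mul_add]
    linarith

end EfronStein

lemma sq_log_sub_log_le_s8 {u v : ℝ} (hu : 0 < u) (hv : 0 < v) :
    (Real.log u - Real.log v) ^ 2 ≤ 2 * (u / v + v / u) := by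
  have key : ∀ {u v : ℝ}, 0 < u → 0 < v → v ≤ u →
      (Real.log u - Real.log v) ^ 2 ≤ 2 * (u / v) := by
    intro u v hu hv h
    have h0 : 0 ≤ Real.log u - Real.log v := sub_nonneg.2 (Real.log_le_log hv h)
    have h1 := Real.quadratic_le_exp_of_nonneg h0
    rw [← Real.log_div hu.ne' hv.ne', Real.exp_log (div_pos hu hv)] at h1
    rw [← Real.log_div hu.ne' hv.ne'] at h0 ⊢
    nlinarith
  have h1 := div_pos hu hv
  have h2 := div_pos hv hu
  rcases le_total v u with h | h
  · linarith [key hu hv h]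
  · rw [← neg_sub, neg_sq]
    linarith [key hv hu h]

/-! ### The law of `∑ aⁱ bᵢ` -/

section Law

variable {ι : Type*}

/-- The point `∑ aⁱ b(xᵢ)`. -/
def digitSum (a : ℤ) (b : ι → ℤ) {n : ℕ} (x : Fin n → ι) : ℤ :=
  ∑ i : Fin n, a ^ (i : ℕ) * b (x i)

lemma digitSum_cons (a : ℤ) (b : ι → ℤ) {n : ℕ} (s : ι) (y : Fin n → ι) :
    digitSum a b (Fin.cons s y : Fin (n + 1) → ι) = b s + a * digitSum a b y := by
  simp [digitSum, Fin.sum_univ_succ, Finset.mul_sum, pow_succ', mul_assoc]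

lemma digitSum_update (a : ℤ) (b : ι → ℤ) {n : ℕ} (x : Fin n → ι) (i : Fin n) (t : ι) :
    digitSum a b (Function.update x i t) = digitSum a b x + a ^ (i : ℕ) * (b t - b (x i)) := by
  unfold digitSum
  rw [← Finset.add_sum_erase _ _ (Finset.mem_univ i),
    ← Finset.add_sum_erase _ (fun j : Fin n => a ^ (j : ℕ) * b (x j)) (Finset.mem_univ i)]
  have : ∑ j ∈ Finset.univ.erase i, a ^ ((j : Fin n) : ℕ) * b (Function.update x i t j)
      = ∑ j ∈ Finset.univ.erase i, a ^ ((j : Fin n) : ℕ) * b (x j) :=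
    Finset.sum_congr rfl fun j hj => by rw [Function.update_of_ne (Finset.ne_of_mem_erase hj)]
  rw [this, Function.update_self]
  ring

variable [Fintype ι]

/-- The law of `digitSum a b` when the digits are independent with law `p`. -/
def digitLaw (a : ℤ) (b : ι → ℤ) (p : ι → ℝ) (n : ℕ) (z : ℤ) : ℝ :=
  ∑ x : Fin n → ι, if digitSum a b x = z then prodWeight p x else 0

lemma hasSum_digitLaw_mul (a : ℤ) (b : ι → ℤ) (p : ι → ℝ) (n : ℕ) (g : ℤ → ℝ) :
    HasSum (fun z => digitLaw a b p n z * g z)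
      (∑ x : Fin n → ι, prodWeight p x * g (digitSum a b x)) := by
  simp only [digitLaw, Finset.sum_mul]
  refine hasSum_sum fun x _ => ?_
  have h := hasSum_single (f := fun z =>
    (if digitSum a b x = z then prodWeight p x else 0) * g z) (digitSum a b x)
    fun z hz => by simp [hz.symm]
  simpa using h

lemma digitLaw_nonneg (a : ℤ) (b : ι → ℤ) {p : ι → ℝ} (hp : ∀ s, 0 ≤ p s) (n : ℕ) (z : ℤ) :
    0 ≤ digitLaw a b p n z :=
  Finset.sum_nonneg fun x _ => by
    split_ifs
    exacts [prodWeight_nonneg hp x, le_rfl]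

lemma hasSum_digitLaw (a : ℤ) (b : ι → ℤ) {p : ι → ℝ} (hp1 : ∑ s, p s = 1) (n : ℕ) :
    HasSum (digitLaw a b p n) 1 := by
  simpa [sum_prodWeight hp1] using hasSum_digitLaw_mul a b p n fun _ => 1

lemma digitLaw_digitSum_pos (a : ℤ) (b : ι → ℤ) {p : ι → ℝ} (hp : ∀ s, 0 < p s) {n : ℕ}
    (x : Fin n → ι) : 0 < digitLaw a b p n (digitSum a b x) := by
  refine Finset.sum_pos' (fun y _ => ?_) ⟨x, Finset.mem_univ x, ?_⟩
  · split_ifs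
    exacts [prodWeight_nonneg (fun s => (hp s).le) y, le_rfl]
  · simpa [prodWeight] using Finset.prod_pos fun i (_ : i ∈ Finset.univ) => hp (x i)

lemma sum_shift_ratio_le (a : ℤ) (b : ι → ℤ) {p : ι → ℝ} (hp : ∀ s, 0 ≤ p s)
    (hp1 : ∑ s, p s = 1) (n : ℕ) (c : ℤ) :
    ∑ x : Fin n → ι, prodWeight p x *
      (digitLaw a b p n (digitSum a b x + c) / digitLaw a b p n (digitSum a b x)) ≤ 1 := by
  refine hasSum_le (fun z => ?_)
    (hasSum_digitLaw_mul a b p n fun z => digitLaw a b p n (z + c) / digitLaw a b p n z)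
    ((Equiv.addRight c).hasSum_iff.2 (hasSum_digitLaw a b hp1 n))
  rcases (digitLaw_nonneg a b hp n z).eq_or_lt with h | h
  · rw [← h, zero_mul]
    exact digitLaw_nonneg a b hp n _
  · rw [mul_div_cancel₀ _ h.ne']
    rfl

lemma sum_resample_ratio_le_s8 (a : ℤ) (b : ι → ℤ) {p : ι → ℝ} (hp : ∀ s, 0 ≤ p s)
    (hp1 : ∑ s, p s = 1) (n : ℕ) (i : Fin n) :
    ∑ x, ∑ t, prodWeight p x * p t *
      (digitLaw a b p n (digitSum a b (Function.update x i t)) /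
        digitLaw a b p n (digitSum a b x)) ≤ Fintype.card ι := by
  have hL := digitLaw_nonneg a b hp n
  have hP := fun x : Fin n → ι => prodWeight_nonneg hp x
  calc _ ≤ ∑ x : Fin n → ι, ∑ t, ∑ s, p t * (prodWeight p x *
            (digitLaw a b p n (digitSum a b x + a ^ (i : ℕ) * (b t - b s)) /
              digitLaw a b p n (digitSum a b x))) := by
        refine Finset.sum_le_sum fun x _ => Finset.sum_le_sum fun t _ => ?_
        rw [digitSum_update, mul_comm (prodWeight p x), mul_assoc]
        exact Finset.single_le_sum (f := fun s => p t * (prodWeight p x *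
            (digitLaw a b p n (digitSum a b x + a ^ (i : ℕ) * (b t - b s)) /
              digitLaw a b p n (digitSum a b x))))
          (fun s _ => mul_nonneg (hp t) (mul_nonneg (hP x) (div_nonneg (hL _) (hL _))))
          (Finset.mem_univ (x i))
    _ = ∑ t, ∑ s, p t * ∑ x : Fin n → ι, prodWeight p x *
            (digitLaw a b p n (digitSum a b x + a ^ (i : ℕ) * (b t - b s)) /
              digitLaw a b p n (digitSum a b x)) := by
        rw [Finset.sum_comm]
        refine Finset.sum_congr rfl fun t _ => ?_
        rw [Finset.sum_comm]
        simp only [Finset.mul_sum]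
    _ ≤ ∑ t, ∑ _s : ι, p t * 1 :=
        Finset.sum_le_sum fun t _ => Finset.sum_le_sum fun s _ =>
          mul_le_mul_of_nonneg_left (sum_shift_ratio_le a b hp hp1 n _) (hp t)
    _ = Fintype.card ι := by simp [← Finset.mul_sum, hp1]

/-- The information content of `digitLaw` has variance growing at most linearly in `n`. -/
lemma variance_log_digitLaw_le (a : ℤ) (b : ι → ℤ) {p : ι → ℝ} (hp : ∀ s, 0 < p s)
    (hp1 : ∑ s, p s = 1) (n : ℕ) :
    ∑ x : Fin n → ι, prodWeight p x * Real.log (digitLaw a b p n (digitSum a b x)) ^ 2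
      - (∑ x : Fin n → ι, prodWeight p x * Real.log (digitLaw a b p n (digitSum a b x))) ^ 2
      ≤ 2 * Fintype.card ι * n := by
  have hp0 : ∀ s, 0 ≤ p s := fun s => (hp s).le
  set w : (Fin n → ι) → ℝ := fun x => digitLaw a b p n (digitSum a b x) with hw
  have hwpos : ∀ x, 0 < w x := digitLaw_digitSum_pos a b hp
  have hi : ∀ i : Fin n, ∑ x, ∑ t, prodWeight p x * p t *
      (Real.log (w x) - Real.log (w (Function.update x i t))) ^ 2 ≤ 4 * Fintype.card ι := by
    intro i
    have hfwd := sum_resample_ratio_le_s8 a b hp0 hp1 n i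
    have hbwd := (sum_resample_swap p i fun x y => w x / w y).trans_le hfwd
    calc _ ≤ ∑ x, ∑ t, prodWeight p x * p t *
            (2 * (w x / w (Function.update x i t) + w (Function.update x i t) / w x)) :=
          Finset.sum_le_sum fun x _ => Finset.sum_le_sum fun t _ =>
            mul_le_mul_of_nonneg_left (sq_log_sub_log_le_s8 (hwpos _) (hwpos _))
              (mul_nonneg (prodWeight_nonneg hp0 x) (hp0 t))
      _ = 2 * (∑ x, ∑ t, prodWeight p x * p t * (w x / w (Function.update x i t))
            + ∑ x, ∑ t, prodWeight p x * p t * (w (Function.update x i t) / w x)) := by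
          simp only [← Finset.sum_add_distrib, Finset.mul_sum]
          exact Finset.sum_congr rfl fun x _ => Finset.sum_congr rfl fun t _ => by ring
      _ ≤ _ := by linarith
  refine (efron_stein_s8 hp0 hp1 n fun x => Real.log (w x)).trans ?_
  have h := Finset.sum_le_sum fun i (_ : i ∈ Finset.univ) => hi i
  simp only [Finset.sum_const, Finset.card_univ, Fintype.card_fin, nsmul_eq_mul] at h
  linarith

lemma hasSum_digitLaw_mul_log (a : ℤ) (b : ι → ℤ) (p : ι → ℝ) (n : ℕ) :
    HasSum (fun z => digitLaw a b p n z * Real.log (digitLaw a b p n z))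
      (-entropy (digitLaw a b p n)) := by
  rw [entropy, neg_neg]
  exact (hasSum_digitLaw_mul a b p n _).summable.hasSum

lemma exists_hasSum_sq_log_add_entropy (a : ℤ) (b : ι → ℤ) {p : ι → ℝ} (hp : ∀ s, 0 < p s)
    (hp1 : ∑ s, p s = 1) (n : ℕ) :
    ∃ V ≤ 2 * Fintype.card ι * (n : ℝ), HasSum (fun z => digitLaw a b p n z *
      (Real.log (digitLaw a b p n z) + entropy (digitLaw a b p n)) ^ 2) V := by
  refine ⟨_, ?_, hasSum_digitLaw_mul a b p n _⟩
  have hH := (hasSum_digitLaw_mul_log a b p n).unique (hasSum_digitLaw_mul a b p n _)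
  refine le_of_eq_of_le ?_ (variance_log_digitLaw_le a b hp hp1 n)
  rw [← hH]
  simp only [add_sq, mul_add, Finset.sum_add_distrib]
  rw [← Finset.sum_mul, sum_prodWeight hp1]
  have h : ∑ x : Fin n → ι, prodWeight p x *
      (2 * Real.log (digitLaw a b p n (digitSum a b x)) * entropy (digitLaw a b p n))
      = 2 * entropy (digitLaw a b p n) * -entropy (digitLaw a b p n) := by
    rw [hH, Finset.mul_sum]
    exact Finset.sum_congr rfl fun x _ => by ring
  rw [h]
  ring

lemma walk_eq_digitLaw (a : ℤ) (b : ι → ℤ) (p : ι → ℝ) {μ : ℤ → ℝ}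
    (hμ : ∀ z, μ z = ∑ s, if b s = z then p s else 0) (n : ℕ) :
    walk a μ n = digitLaw a b p n := by
  induction n with
  | zero =>
    ext z
    simp [walk, digitLaw, digitSum, prodWeight, eq_comm]
  | succ n ih =>
    ext z
    have h := hasSum_digitLaw_mul a b p n fun y => μ (z - a * y)
    rw [walk, step, ih, tsum_congr fun y => mul_comm _ _, h.tsum_eq]
    simp only [hμ, digitLaw, sum_cons, digitSum_cons, prodWeight_cons, Finset.mul_sum]
    rw [Finset.sum_comm]
    refine Finset.sum_congr rfl fun s _ => Finset.sum_congr rfl fun y _ => ?_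
    simp only [eq_sub_iff_add_eq, mul_ite, mul_zero, mul_comm]

end Law

/-- Conditioning a probability measure on the set where its information content is within `r` of
`H`, an event of large probability by Chebyshev's inequality. -/
lemma exists_flat_conditioning {α : Type*} {w : α → ℝ} (hw : ∀ z, 0 ≤ w z) (hw1 : HasSum w 1)
    {H V r : ℝ} (hr : 0 < r) (hV : HasSum (fun z => w z * (Real.log (w z) + H) ^ 2) V)
    (hVr : V ≤ r ^ 2 / 2) :
    ∃ ν : α → ℝ, (∀ x, 0 ≤ ν x) ∧ (∑' x, ν x) = 1 ∧ (∑' x, |w x - ν x|) ≤ 2 * V / r ^ 2 ∧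
      Function.support ν ⊆ Function.support w ∧
      ∀ x ∈ Function.support ν, |Real.log (ν x) + H| ≤ r + 1 := by
  set A : Set α := {z | |Real.log (w z) + H| ≤ r} with hA
  obtain ⟨G, hG⟩ : ∃ G, HasSum (A.indicator w) G := hw1.summable.indicator A
  have hB : 1 - G ≤ V / r ^ 2 := by
    refine hasSum_le (fun z => ?_) (hw1.sub hG) (hV.div_const _)
    by_cases hz : z ∈ A
    · rw [Set.indicator_of_mem hz, sub_self]
      have := hw z
      positivity
    · rw [Set.indicator_of_notMem hz, sub_zero, mul_div_assoc]
      refine le_mul_of_one_le_right (hw z) ((one_le_div (by positivity)).2 ?_)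
      rw [← sq_abs (_ + H)]
      exact pow_le_pow_left₀ hr.le (not_le.1 hz).le 2
  have hB' : V / r ^ 2 ≤ 1 / 2 := by
    rw [div_le_iff₀ (by positivity)]
    linarith
  have hG0 : 1 / 2 ≤ G := by linarith
  have hGpos : 0 < G := by linarith
  have hG1 : G ≤ 1 := hasSum_le (fun z => Set.indicator_le_self' (fun _ _ => hw z) z) hG hw1
  have hinv : 1 ≤ G⁻¹ := (one_le_inv₀ hGpos).2 hG1
  have hmem : ∀ x, A.indicator w x / G ≠ 0 → x ∈ A ∧ w x ≠ 0 := by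
    intro x hx
    by_cases hz : x ∈ A
    · refine ⟨hz, fun h => hx ?_⟩
      simp [hz, h]
    · simp [hz] at hx
  refine ⟨fun x => A.indicator w x / G,
    fun x => div_nonneg (Set.indicator_nonneg (fun z _ => hw z) x) hGpos.le, ?_, ?_,
    fun x hx => (hmem x hx).2, fun x hx => ?_⟩
  · rw [(hG.div_const G).tsum_eq, div_self hGpos.ne']
  · have h : ∀ x, |w x - A.indicator w x / G|
        = w x - A.indicator w x + A.indicator w x * (G⁻¹ - 1) := by
      intro x
      by_cases hz : x ∈ A
      · rw [Set.indicator_of_mem hz, abs_sub_comm, abs_of_nonneg, div_eq_mul_inv]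
        · ring
        · rw [div_eq_mul_inv, sub_nonneg]
          exact le_mul_of_one_le_right (hw x) hinv
      · simp [hz, abs_of_nonneg (hw x)]
    simp only [h]
    rw [((hw1.sub hG).add (hG.mul_right (G⁻¹ - 1))).tsum_eq, mul_sub, mul_inv_cancel₀ hGpos.ne',
      mul_div_assoc]
    linarith
  · obtain ⟨hxA, hx0⟩ := hmem x hx
    have h1 : |Real.log G| ≤ 1 := by
      rw [abs_of_nonpos (Real.log_nonpos hGpos.le hG1), ← Real.log_inv]
      have : G⁻¹ ≤ 2 := by
        rw [inv_le_comm₀ hGpos two_pos]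
        linarith
      linarith [Real.log_le_sub_one_of_pos (inv_pos.2 hGpos)]
    simp only [Set.indicator_of_mem hxA]
    rw [Real.log_div hx0 hGpos.ne', sub_add_eq_add_sub]
    exact (abs_sub _ _).trans (add_le_add hxA h1)

/-- there is `C` depending only on `a` and `μ` such that for every `n ≥ 1` and
every `α > 0` with `α²·n ≥ 2C` there is a probability measure `ν_n` on `ℤ` with
(1) `‖μ_n − ν_n‖ ≤ C/(α²·n)`; (2) `supp ν_n ⊆ supp μ_n`;
(3) `|log ν_n({x}) + H(μ_n)| ≤ C·α·n` for every `x ∈ supp ν_n`. -/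
theorem stmt8 (a : ℤ) (ha : 1 < a) (μ : ℤ → ℝ) (hμ : IsGoodMeasure μ) :
    ∃ C : ℝ, ∀ n : ℕ, 1 ≤ n → ∀ α : ℝ, 0 < α → 2 * C ≤ α ^ 2 * n →
      ∃ ν : ℤ → ℝ, (∀ x, 0 ≤ ν x) ∧ (∑' x, ν x) = 1 ∧
        (∑' x : ℤ, |walk a μ n x - ν x|) ≤ C / (α ^ 2 * n) ∧
        Function.support ν ⊆ Function.support (walk a μ n) ∧
        ∀ x ∈ Function.support ν, |Real.log (ν x) + entropy (walk a μ n)| ≤ C * α * n := by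
  set S : Finset ℤ := hμ.finsupp.toFinset with hS
  have hSmem : ∀ z, z ∈ S ↔ μ z ≠ 0 := fun z => by simp [hS]
  have hp : ∀ s : S, 0 < μ s := fun s => (hμ.nonneg _).lt_of_ne' ((hSmem _).1 s.2)
  have hp1 : ∑ s : S, μ s = 1 := by
    rw [Finset.sum_coe_sort S μ, ← hμ.total, tsum_eq_sum fun z hz => ?_]
    exact not_not.1 (mt (hSmem z).2 hz)
  have hlaw : ∀ z, μ z = ∑ s : S, if (s : ℤ) = z then μ s else 0 := by
    intro z
    rw [Finset.sum_coe_sort S fun y => if y = z then μ y else 0, Finset.sum_ite_eq' S z μ]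
    split_ifs with hz
    exacts [rfl, not_not.1 (mt (hSmem z).2 hz)]
  obtain ⟨k, hk⟩ : ∃ k : ℝ, k = (Fintype.card S : ℝ) := ⟨_, rfl⟩
  have hk0 : 0 ≤ k := hk ▸ Nat.cast_nonneg _
  refine ⟨4 * k + 2, fun n hn α hα hαn => ?_⟩
  have hn1 : (1 : ℝ) ≤ n := by exact_mod_cast hn
  have hr : 0 < α * n := by positivity
  have hrsq : (α * n) ^ 2 = α ^ 2 * n * n := by ring
  obtain ⟨V, hVle, hV⟩ :=
    exists_hasSum_sq_log_add_entropy a (fun s : S => (s : ℤ)) hp hp1 n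
  rw [← hk] at hVle
  rw [walk_eq_digitLaw a (fun s : S => (s : ℤ)) (fun s : S => μ s) hlaw n]
  obtain ⟨ν, hν0, hν1, hdist, hsupp, hlog⟩ := exists_flat_conditioning
    (digitLaw_nonneg a _ (fun s => (hp s).le) n) (hasSum_digitLaw a _ hp1 n) hr hV (by
      rw [hrsq]
      nlinarith)
  refine ⟨ν, hν0, hν1, hdist.trans ?_, hsupp, fun x hx => (hlog x hx).trans ?_⟩
  · rw [hrsq, div_le_div_iff₀ (by positivity) (by positivity)]
    have : 2 * V ≤ (4 * k + 2) * n := by nlinarith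
    nlinarith [mul_le_mul_of_nonneg_right this (by positivity : 0 ≤ α ^ 2 * (n : ℝ))]
  · have h1 : 1 ≤ α * n := by
      refine (one_le_sq_iff₀ hr.le).1 ?_
      rw [hrsq]
      nlinarith
    nlinarith
end
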